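/- (Monotone descent with adaptive proximal errors.) Let h : ℝ^N → ℝ be arbitrary, let g : ℝ^N → ℝ be differentiable with L-Lipschitz continuous gradient, let f = g + h, let γ > 0 and α ≥ 0 satisfy 1/(2γ) − L/2 − α > 0. Let x, v, v₊ ∈ ℝ^N with f(x) ≤ f(v), and suppose v₊ ∈ Prox^ε_{γh}(x − γ∇g(x)) with ε = α·‖v₊ − x‖². Then f(v₊) ≤ f(v) − (1/(2γ) − L/2 − α)·‖v₊ − x‖²; in particular f(v₊) ≤ f(v) and ‖v₊ − x‖² ≤ ( f(v) − f(v₊) ) / ( 1/(2γ) − L/2 − α ). -/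

import Mathlib

open scoped RealInnerProductSpace
open Filter Topology

noncomputable section

abbrev E (N : ℕ) := EuclideanSpace ℝ (Fin N)

/-- `z` is an `ε`-inexact proximal point of `h` with stepsize `γ` at `y`:
`(1/(2γ))‖z − y‖² + h(z) ≤ ε + (1/(2γ))‖x − y‖² + h(x)` for all `x`. -/
def IsInexactProx {N : ℕ} (γ : ℝ) (h : E N → ℝ) (ε : ℝ) (y z : E N) : Prop :=
  ∀ x : E N, 1 / (2 * γ) * ‖z - y‖ ^ 2 + h z ≤ ε + 1 / (2 * γ) * ‖x - y‖ ^ 2 + h x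

/-- The `ε`-approximate subdifferential of `h` at `x`. -/
def epsSubdiff {N : ℕ} (h : E N → ℝ) (ε : ℝ) (x : E N) : Set (E N) :=
  {d : E N | ∀ y : E N, h y ≥ h x + ⟪d, y - x⟫ - ε}


/-- The descent lemma: a function with `L`-Lipschitz gradient lies below its quadratic model. -/
theorem le_add_inner_add_of_lipschitz_gradient {F : Type*} [NormedAddCommGroup F]
    [InnerProductSpace ℝ F] [CompleteSpace F] {g : F → ℝ} {g' : F → F} {L : ℝ}
    (hg : ∀ x, HasGradientAt g (g' x) x)
    (hlip : ∀ x y, ‖g' x - g' y‖ ≤ L * ‖x - y‖) (x y : F) :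
    g y ≤ g x + ⟪g' x, y - x⟫ + L / 2 * ‖y - x‖ ^ 2 := by
  set d := y - x with hd
  have hline (t : ℝ) : HasDerivAt (fun t : ℝ => g (x + t • d)) ⟪g' (x + t • d), d⟫ t := by
    have hray : HasDerivAt (fun t : ℝ => x + t • d) d t := by
      simpa using ((hasDerivAt_id t).smul_const d).const_add x
    have hcomp := (hg (x + t • d)).hasFDerivAt.comp_hasDerivAt t hray
    rwa [InnerProductSpace.toDual_apply_apply] at hcomp
  have hmodel (t : ℝ) : HasDerivAt
      (fun t : ℝ => g x + t * ⟪g' x, d⟫ + L / 2 * ‖d‖ ^ 2 * t ^ 2)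
      (⟪g' x, d⟫ + L * t * ‖d‖ ^ 2) t := by
    have hsum := (((hasDerivAt_id' t).mul_const ⟪g' x, d⟫).const_add (g x)).add
      ((hasDerivAt_pow 2 t).const_mul (L / 2 * ‖d‖ ^ 2))
    refine hsum.congr_deriv ?_
    norm_num
    ring
  have hderiv (t : ℝ) (ht : 0 ≤ t) :
      ⟪g' (x + t • d), d⟫ ≤ ⟪g' x, d⟫ + L * t * ‖d‖ ^ 2 := by
    have hgrad : ‖g' (x + t • d) - g' x‖ ≤ L * (t * ‖d‖) := by
      simpa [norm_smul, abs_of_nonneg ht] using hlip (x + t • d) x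
    have hinner := real_inner_le_norm (g' (x + t • d) - g' x) d
    rw [inner_sub_left] at hinner
    nlinarith [mul_le_mul_of_nonneg_right hgrad (norm_nonneg d)]
  have hle := image_le_of_deriv_right_le_deriv_boundary (a := 0) (b := 1)
    (fun t _ => (hline t).continuousAt.continuousWithinAt)
    (fun t _ => (hline t).hasDerivWithinAt) (by simp)
    (fun t _ => (hmodel t).continuousAt.continuousWithinAt)
    (fun t _ => (hmodel t).hasDerivWithinAt)
    (fun t ht => hderiv t ht.1) (Set.right_mem_Icc.2 zero_le_one)
  simpa [hd] using hle

/-- monotone descent with adaptive proximal errors. -/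
theorem adaptive_error_monotone_descent {N : ℕ} (g h : E N → ℝ) (g' : E N → E N)
    (L γ α : ℝ) (hL : 0 < L)
    (hg : ∀ x, HasGradientAt g (g' x) x)
    (hlip : ∀ x y, ‖g' x - g' y‖ ≤ L * ‖x - y‖)
    (hγ0 : 0 < γ) (hα : 0 ≤ α) (hcoef : 0 < 1 / (2 * γ) - L / 2 - α)
    (x v vp : E N)
    (hfx : g x + h x ≤ g v + h v)
    (hstep : IsInexactProx γ h (α * ‖vp - x‖ ^ 2) (x - γ • g' x) vp) :
    g vp + h vp ≤ g v + h v - (1 / (2 * γ) - L / 2 - α) * ‖vp - x‖ ^ 2 ∧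
    g vp + h vp ≤ g v + h v ∧
    ‖vp - x‖ ^ 2 ≤ (g v + h v - (g vp + h vp)) / (1 / (2 * γ) - L / 2 - α) := by
  have hdesc := le_add_inner_add_of_lipschitz_gradient hg hlip x vp
  have hprox := hstep x
  have hvp : vp - (x - γ • g' x) = (vp - x) + γ • g' x := by abel
  have hx : x - (x - γ • g' x) = γ • g' x := by abel
  rw [hvp, hx, norm_add_sq_real, real_inner_smul_right, real_inner_comm] at hprox
  have hcancel : 1 / (2 * γ) * (2 * (γ * ⟪g' x, vp - x⟫)) = ⟪g' x, vp - x⟫ := by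
    field_simp
  have hmain : g vp + h vp ≤ g v + h v - (1 / (2 * γ) - L / 2 - α) * ‖vp - x‖ ^ 2 := by
    linarith
  have hnonneg := mul_nonneg hcoef.le (sq_nonneg ‖vp - x‖)
  refine ⟨hmain, by linarith, ?_⟩
  rw [le_div_iff₀ hcoef]
  linarith
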